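/- arXiv:1807.00131 — 2 statements merged into one kernel-verified Lean document; each statement's English description precedes it below -/
import Mathlib

section
/- Let P_m and P_n be path graphs on m and n vertices respectively with m ≠ n, and let r_m and r_n be their transitivity numbers (the numbers of orbits of their automorphism groups on their vertex sets). Then the transitivity number of the Cartesian product P_m □ P_n equals r_m · r_n. -/
/-- The orbit of a vertex `v` under the automorphism group of `G`
(the transitivity partition containing `v`). -/
def autOrbit {V : Type*} (G : SimpleGraph V) (v : V) : Set V :=
  {u : V | ∃ σ : G ≃g G, σ v = u}

/-- The transitivity number of `G`: the number of orbits of `Aut(G)` on `V(G)`. -/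
noncomputable def transitivityNumber {V : Type*} (G : SimpleGraph V) : ℕ :=
  (Set.range (autOrbit G)).ncard

open SimpleGraph in
/-- Reversal of a path. -/
def pathRev (n : ℕ) : pathGraph n ≃g pathGraph n where
  toEquiv := Fin.revPerm
  map_rel_iff' := by
    intro a b
    simp only [pathGraph_adj, Fin.revPerm_apply, Fin.val_rev]
    omega

open SimpleGraph in
/-- Product of automorphisms. -/
def boxIso {V W : Type*} {G : SimpleGraph V} {H : SimpleGraph W} (f : G ≃g G) (g : H ≃g H) :
    G.boxProd H ≃g G.boxProd H where
  toEquiv := Equiv.prodCongr f.toEquiv g.toEquiv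
  map_rel_iff' := by
    rintro ⟨a, b⟩ ⟨c, d⟩
    have h1 : G.Adj (f a) (f c) ↔ G.Adj a c := f.map_rel_iff
    have h2 : H.Adj (g b) (g d) ↔ H.Adj b d := g.map_rel_iff
    simp [boxProd_adj, h1, h2]

/-- Grid distance. -/
def gridDist {m n : ℕ} (u v : Fin m × Fin n) : ℕ :=
  ((u.1.val - v.1.val) + (v.1.val - u.1.val)) + ((u.2.val - v.2.val) + (v.2.val - u.2.val))

lemma gridDist_adj {m n : ℕ} {u w : Fin m × Fin n}
    (h : ((SimpleGraph.pathGraph m).boxProd (SimpleGraph.pathGraph n)).Adj u w) :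
    gridDist u w = 1 := by
  simp only [SimpleGraph.boxProd_adj, SimpleGraph.pathGraph_adj, Fin.ext_iff] at h
  unfold gridDist
  omega

lemma gridDist_step {m n k : ℕ} (u v : Fin m × Fin n) (h : gridDist u v = k + 1) :
    ∃ w, ((SimpleGraph.pathGraph m).boxProd (SimpleGraph.pathGraph n)).Adj u w ∧
      gridDist w v = k := by
  obtain ⟨⟨a, ha⟩, ⟨b, hb⟩⟩ := u
  obtain ⟨⟨c, hc⟩, ⟨d, hd⟩⟩ := v
  simp only [gridDist] at h
  rcases lt_trichotomy a c with h1 | h1 | h1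
  · refine ⟨(⟨a + 1, by omega⟩, ⟨b, hb⟩), ?_, ?_⟩
    · simp [SimpleGraph.boxProd_adj, SimpleGraph.pathGraph_adj]
    · simp only [gridDist]; omega
  · rcases lt_trichotomy b d with h2 | h2 | h2
    · refine ⟨(⟨a, ha⟩, ⟨b + 1, by omega⟩), ?_, ?_⟩
      · simp [SimpleGraph.boxProd_adj, SimpleGraph.pathGraph_adj]
      · simp only [gridDist]; omega
    · omega
    · refine ⟨(⟨a, ha⟩, ⟨b - 1, by omega⟩), ?_, ?_⟩
      · simp only [SimpleGraph.boxProd_adj, SimpleGraph.pathGraph_adj, and_true]; omega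
      · simp only [gridDist]; omega
  · refine ⟨(⟨a - 1, by omega⟩, ⟨b, hb⟩), ?_, ?_⟩
    · simp only [SimpleGraph.boxProd_adj, SimpleGraph.pathGraph_adj, and_true]; omega
    · simp only [gridDist]; omega

lemma gridDist_le {m n : ℕ} (σ : ((SimpleGraph.pathGraph m).boxProd (SimpleGraph.pathGraph n)) ≃g
    ((SimpleGraph.pathGraph m).boxProd (SimpleGraph.pathGraph n))) (k : ℕ) :
    ∀ u v, gridDist u v = k → gridDist (σ u) (σ v) ≤ k := by
  induction k with
  | zero =>
    intro u v h
    have : u = v := by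
      ext <;> · unfold gridDist at h; omega
    subst this
    simp [gridDist]
  | succ k ih =>
    intro u v h
    obtain ⟨w, hw, hd⟩ := gridDist_step u v h
    have h1 := gridDist_adj (σ.map_rel_iff.2 hw)
    have h2 := ih w v hd
    unfold gridDist at *
    omega

lemma gridDist_eq {m n : ℕ} (σ : ((SimpleGraph.pathGraph m).boxProd (SimpleGraph.pathGraph n)) ≃g
    ((SimpleGraph.pathGraph m).boxProd (SimpleGraph.pathGraph n))) (u v : Fin m × Fin n) :
    gridDist (σ u) (σ v) = gridDist u v := by
  apply le_antisymm (gridDist_le σ _ _ _ rfl)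
  simpa using gridDist_le σ.symm _ (σ u) (σ v) rfl

lemma grid_arith {M N a b c d x0 y0 x2 y2 : ℕ}
    (hMN : M ≠ N) (ha : a ≤ M) (hb : b ≤ N) (hc : c ≤ M) (hd : d ≤ N)
    (h0 : (x0 = 0 ∨ x0 = M) ∧ (y0 = 0 ∨ y0 = N))
    (h2 : (x2 = 0 ∨ x2 = M) ∧ (y2 = 0 ∨ y2 = N))
    (h02 : ((x0 - x2) + (x2 - x0)) + ((y0 - y2) + (y2 - y0)) = M)
    (e0 : ((c - x0) + (x0 - c)) + ((d - y0) + (y0 - d)) = a + b)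
    (e2 : ((c - x2) + (x2 - c)) + ((d - y2) + (y2 - d)) = M - a + b) :
    (c = a ∨ c + a = M) ∧ (d = b ∨ d + b = N) := by
  have hx : x2 + x0 = M ∧ y2 = y0 := by
    clear e0 e2 ha hb hc hd
    obtain ⟨h0 | h0, h0b | h0b⟩ := h0 <;> obtain ⟨h2 | h2, h2b | h2b⟩ := h2 <;>
      rw [h0, h0b, h2, h2b] at h02 ⊢ <;> clear h0 h0b h2 h2b <;> omega
  obtain ⟨hx, rfl⟩ := hx
  have hcM : c - M = 0 := by omega
  have hdN : d - N = 0 := by omega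
  clear h2 h02
  obtain ⟨h0 | h0, h0b | h0b⟩ := h0
  · obtain rfl : x2 = M := by omega
    subst h0 h0b
    simp only [Nat.sub_zero, Nat.zero_sub, hcM] at e0 e2
    omega
  · obtain rfl : x2 = M := by omega
    subst h0 h0b
    simp only [Nat.sub_zero, Nat.zero_sub, hcM, hdN] at e0 e2
    omega
  · obtain rfl : x2 = 0 := by omega
    subst h0 h0b
    simp only [Nat.sub_zero, Nat.zero_sub, hcM] at e0 e2
    omega
  · obtain rfl : x2 = 0 := by omega
    subst h0 h0b
    simp only [Nat.sub_zero, Nat.zero_sub, hcM, hdN] at e0 e2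
    omega

lemma corner_arith {M N x y xb yb : ℕ} (hx : x ≤ M) (hy : y ≤ N) (hxb : xb ≤ M) (hyb : yb ≤ N)
    (h : ((x - xb) + (xb - x)) + ((y - yb) + (yb - y)) = M + N) :
    (x = 0 ∨ x = M) ∧ (y = 0 ∨ y = N) := by
  omega

lemma grid_aut {m n : ℕ} (hmn : m ≠ n)
    (σ : ((SimpleGraph.pathGraph m).boxProd (SimpleGraph.pathGraph n)) ≃g
    ((SimpleGraph.pathGraph m).boxProd (SimpleGraph.pathGraph n))) (v : Fin m × Fin n) :
    ((σ v).1 = v.1 ∨ (σ v).1 = v.1.rev) ∧ ((σ v).2 = v.2 ∨ (σ v).2 = v.2.rev) := by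
  have hm : 0 < m := v.1.pos
  have hn : 0 < n := v.2.pos
  obtain ⟨M, rfl⟩ : ∃ M, m = M + 1 := ⟨m - 1, by omega⟩
  obtain ⟨N, rfl⟩ : ∃ N, n = N + 1 := ⟨n - 1, by omega⟩
  have d01 := gridDist_eq σ (0, 0) (Fin.last M, Fin.last N)
  have d23 := gridDist_eq σ (Fin.last M, 0) (0, Fin.last N)
  have d02 := gridDist_eq σ (0, 0) (Fin.last M, 0)
  have e0 := gridDist_eq σ v (0, 0)
  have e2 := gridDist_eq σ v (Fin.last M, 0)
  generalize σ v = w at *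
  generalize σ (0, 0) = p0 at *
  generalize σ (Fin.last M, 0) = p2 at *
  generalize σ (0, Fin.last N) = p3 at *
  generalize σ (Fin.last M, Fin.last N) = p1 at *
  obtain ⟨⟨a, ha⟩, ⟨b, hb⟩⟩ := v
  obtain ⟨⟨c, hc⟩, ⟨d, hd⟩⟩ := w
  obtain ⟨⟨x0, hx0⟩, ⟨y0, hy0⟩⟩ := p0
  obtain ⟨⟨x1, hx1⟩, ⟨y1, hy1⟩⟩ := p1
  obtain ⟨⟨x2, hx2⟩, ⟨y2, hy2⟩⟩ := p2
  obtain ⟨⟨x3, hx3⟩, ⟨y3, hy3⟩⟩ := p3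
  simp only [gridDist, Fin.val_last, Fin.val_zero] at *
  simp only [Nat.sub_zero, Nat.zero_sub, Nat.zero_add, Nat.add_zero, Nat.sub_self,
    Nat.sub_eq_zero_of_le (Nat.le_of_lt_succ ha)] at d01 d23 d02 e0 e2
  have h0 := corner_arith (Nat.le_of_lt_succ hx0) (Nat.le_of_lt_succ hy0)
    (Nat.le_of_lt_succ hx1) (Nat.le_of_lt_succ hy1) d01
  have h2 := corner_arith (Nat.le_of_lt_succ hx2) (Nat.le_of_lt_succ hy2)
    (Nat.le_of_lt_succ hx3) (Nat.le_of_lt_succ hy3) d23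
  have := grid_arith (fun h => hmn (congrArg (· + 1) h)) (Nat.le_of_lt_succ ha)
    (Nat.le_of_lt_succ hb) (Nat.le_of_lt_succ hc) (Nat.le_of_lt_succ hd) h0 h2 d02 e0 e2
  clear d01 d23 d02 e0 e2 h0 h2
  simp only [Fin.ext_iff, Fin.val_rev]
  omega

lemma autOrbit_box {m n : ℕ} (hmn : m ≠ n) (v : Fin m × Fin n) :
    autOrbit ((SimpleGraph.pathGraph m).boxProd (SimpleGraph.pathGraph n)) v =
      autOrbit (SimpleGraph.pathGraph m) v.1 ×ˢ autOrbit (SimpleGraph.pathGraph n) v.2 := by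
  ext u
  constructor
  · rintro ⟨σ, rfl⟩
    obtain ⟨h1, h2⟩ := grid_aut hmn σ v
    constructor
    · rcases h1 with h | h
      · exact ⟨SimpleGraph.Iso.refl, h.symm⟩
      · exact ⟨pathRev m, h.symm⟩
    · rcases h2 with h | h
      · exact ⟨SimpleGraph.Iso.refl, h.symm⟩
      · exact ⟨pathRev n, h.symm⟩
  · rintro ⟨⟨f, hf⟩, ⟨g, hg⟩⟩
    exact ⟨boxIso f g, Prod.ext hf hg⟩

/-- For paths `P_m` and `P_n` with `m ≠ n`, the transitivity number of the
Cartesian product `P_m □ P_n` is the product of their transitivity numbers. -/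
theorem transitivityNumber_boxProd_paths (m n : ℕ) (hmn : m ≠ n) :
    transitivityNumber ((SimpleGraph.pathGraph m).boxProd (SimpleGraph.pathGraph n)) =
      transitivityNumber (SimpleGraph.pathGraph m) *
        transitivityNumber (SimpleGraph.pathGraph n) := by
  unfold transitivityNumber
  rw [← Set.ncard_prod]
  have key : Set.range (autOrbit ((SimpleGraph.pathGraph m).boxProd (SimpleGraph.pathGraph n))) =
      (fun p : Set (Fin m) × Set (Fin n) => p.1 ×ˢ p.2) ''
        (Set.range (autOrbit (SimpleGraph.pathGraph m)) ×ˢ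
          Set.range (autOrbit (SimpleGraph.pathGraph n))) := by
    ext s
    constructor
    · rintro ⟨v, rfl⟩
      exact ⟨(_, _), ⟨⟨v.1, rfl⟩, ⟨v.2, rfl⟩⟩, (autOrbit_box hmn v).symm⟩
    · rintro ⟨⟨_, _⟩, ⟨⟨a, rfl⟩, ⟨b, rfl⟩⟩, rfl⟩
      exact ⟨(a, b), autOrbit_box hmn (a, b)⟩
  rw [key]
  apply Set.InjOn.ncard_image
  rintro ⟨_, _⟩ ⟨⟨a, rfl⟩, ⟨b, rfl⟩⟩ ⟨s, t⟩ - h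
  have hne : (autOrbit (SimpleGraph.pathGraph m) a ×ˢ
      autOrbit (SimpleGraph.pathGraph n) b).Nonempty :=
    ⟨(a, b), ⟨SimpleGraph.Iso.refl, rfl⟩, ⟨SimpleGraph.Iso.refl, rfl⟩⟩
  obtain ⟨h1, h2⟩ := (Set.prod_eq_prod_iff_of_nonempty hne).1 h
  exact Prod.ext h1 h2
end

section
/- Let P be a path graph on n vertices with transitivity number r. Then the transitivity number of the Cartesian product P □ P equals r(r+1)/2. -/
open SimpleGraph in
lemma edist_iso_le {V : Type*} {G : SimpleGraph V} (σ : G ≃g G) (u v : V) :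
    G.edist (σ u) (σ v) ≤ G.edist u v := by
  by_cases h : G.edist u v = ⊤
  · rw [h]; exact le_top
  · obtain ⟨w, hw⟩ := exists_walk_of_edist_ne_top h
    rw [← hw]
    have := edist_le (w.map σ.toHom)
    rw [Walk.length_map] at this
    exact this

lemma edist_iso {V : Type*} {G : SimpleGraph V} (σ : G ≃g G) (u v : V) :
    G.edist (σ u) (σ v) = G.edist u v := by
  refine le_antisymm (edist_iso_le σ u v) ?_
  have := edist_iso_le σ.symm (σ u) (σ v)
  simpa using this

/-- Absolute difference of natural numbers. -/
def ad (i j : ℕ) : ℕ := (i - j) + (j - i)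

lemma path_edist_le (n k : ℕ) : ∀ i j : Fin n, (j : ℕ) = i + k →
    (SimpleGraph.pathGraph n).edist i j ≤ k := by
  induction k with
  | zero =>
    intro i j h
    have : i = j := by ext; omega
    subst this
    simp
  | succ k ih =>
    intro i j h
    have hj := j.2
    let m : Fin n := ⟨i + k, by omega⟩
    have h1 := ih i m rfl
    have h2 : (SimpleGraph.pathGraph n).edist m j = 1 := by
      rw [SimpleGraph.edist_eq_one_iff_adj, SimpleGraph.pathGraph_adj]
      left
      simp only [m]; omega
    calc _ ≤ (SimpleGraph.pathGraph n).edist i m + (SimpleGraph.pathGraph n).edist m j :=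
          SimpleGraph.edist_triangle
      _ ≤ k + 1 := by rw [h2]; gcongr
      _ = _ := by push_cast; rfl

lemma path_walk_ge {n : ℕ} {i j : Fin n} (w : (SimpleGraph.pathGraph n).Walk i j) :
    ad i j ≤ w.length := by
  induction w with
  | nil => simp [ad]
  | cons h p ih =>
    rw [SimpleGraph.pathGraph_adj] at h
    rw [SimpleGraph.Walk.length_cons]
    unfold ad at *
    omega

lemma path_edist (n : ℕ) (i j : Fin n) :
    (SimpleGraph.pathGraph n).edist i j = (ad i j : ℕ) := by
  apply le_antisymm
  · rcases le_total (i : ℕ) j with h | h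
    · exact path_edist_le n _ i j (by unfold ad; omega)
    · rw [SimpleGraph.edist_comm]
      exact path_edist_le n _ j i (by unfold ad; omega)
  · by_cases h : (SimpleGraph.pathGraph n).edist i j = ⊤
    · rw [h]; exact le_top
    · obtain ⟨w, hw⟩ := SimpleGraph.exists_walk_of_edist_ne_top h
      rw [← hw]
      exact_mod_cast path_walk_ge w

/-- Distance to the nearest end of the path. -/
def fold (n : ℕ) (i : Fin n) : ℕ := min (i : ℕ) (n - 1 - i)

lemma fold_far (n : ℕ) (i : Fin n) : ∃ k : Fin n, ad i k = n - 1 - fold n i := by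
  have hi := i.2
  rcases le_total (i : ℕ) (n - 1 - i) with h | h
  · refine ⟨⟨n - 1, by omega⟩, ?_⟩
    unfold fold ad; simp only; omega
  · refine ⟨⟨0, by omega⟩, ?_⟩
    unfold fold ad; simp only; omega

lemma fold_le (n : ℕ) (i k : Fin n) : ad i k + fold n i ≤ n - 1 := by
  have := i.2
  have := k.2
  unfold fold ad; omega

lemma fold_lt (n : ℕ) (i : Fin n) : fold n i < (n + 1) / 2 := by
  have := i.2
  unfold fold; omega

lemma sum_ad_aux (i m : ℕ) : 
    2 * ∑ k ∈ Finset.range (i + 1 + m), ad i k = i * (i + 1) + m * (m + 1) := by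
  induction m with
  | zero =>
    have h : ∀ k ∈ Finset.range (i + 1), ad i k = i + 1 - 1 - k := by
      intro k hk
      rw [Finset.mem_range] at hk
      unfold ad; omega
    rw [add_zero, Finset.sum_congr rfl h, Finset.sum_range_reflect (fun k => k), mul_comm,
      Finset.sum_range_id_mul_two]
    simp [mul_comm]
  | succ m ih =>
    rw [← add_assoc, Finset.sum_range_succ, mul_add, ih]
    have : ad i (i + 1 + m) = m + 1 := by unfold ad; omega
    rw [this]; ring

lemma sum_ad (n : ℕ) (i : Fin n) :
    2 * ∑ k : Fin n, ad i k =
      fold n i * (fold n i + 1) + (n - 1 - fold n i) * (n - 1 - fold n i + 1) := by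
  have hi := i.2
  rw [Fin.sum_univ_eq_sum_range (fun k => ad i k) n]
  have h := sum_ad_aux i (n - 1 - i)
  rw [show (i : ℕ) + 1 + (n - 1 - i) = n by omega] at h
  rw [h]
  rcases le_total (i : ℕ) (n - 1 - i) with h | h
  · rw [show fold n i = i by unfold fold; omega]
  · rw [show fold n i = n - 1 - i by unfold fold; omega,
      show n - 1 - (n - 1 - (i : ℕ)) = i by omega, add_comm]

lemma path_ad_iso {n : ℕ} (σ : SimpleGraph.pathGraph n ≃g SimpleGraph.pathGraph n)
    (i j : Fin n) : ad (σ i) (σ j) = ad i j := by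
  have := edist_iso σ i j
  rw [path_edist, path_edist] at this
  exact_mod_cast this

lemma path_fold_iso_le {n : ℕ} (σ : SimpleGraph.pathGraph n ≃g SimpleGraph.pathGraph n)
    (i : Fin n) : fold n (σ i) ≤ fold n i := by
  obtain ⟨k, hk⟩ := fold_far n i
  have h1 := fold_le n (σ i) (σ k)
  rw [path_ad_iso] at h1
  have := fold_lt n i
  omega

lemma path_fold_iso {n : ℕ} (σ : SimpleGraph.pathGraph n ≃g SimpleGraph.pathGraph n)
    (i : Fin n) : fold n (σ i) = fold n i := by
  refine le_antisymm (path_fold_iso_le σ i) ?_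
  simpa using path_fold_iso_le σ.symm (σ i)

/-- The reflection of the path. -/
def revIso (n : ℕ) : SimpleGraph.pathGraph n ≃g SimpleGraph.pathGraph n where
  toEquiv := Fin.revPerm
  map_rel_iff' := by
    intro a b
    have := a.2
    have := b.2
    simp only [SimpleGraph.pathGraph_adj, Fin.revPerm_apply, Fin.val_rev]
    omega

lemma path_exists_iso {n : ℕ} (i j : Fin n) (h : fold n i = fold n j) :
    ∃ σ : SimpleGraph.pathGraph n ≃g SimpleGraph.pathGraph n, σ i = j := by
  have hi := i.2
  have hj := j.2
  by_cases hij : i = j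
  · exact ⟨SimpleGraph.Iso.refl, hij⟩
  · refine ⟨revIso n, ?_⟩
    change Fin.rev i = j
    ext
    rw [Fin.val_rev]
    have : (i : ℕ) ≠ j := fun h => hij (Fin.ext h)
    unfold fold at h
    omega

/-- Abbreviation for the grid. -/
abbrev grid (n : ℕ) : SimpleGraph (Fin n × Fin n) :=
  (SimpleGraph.pathGraph n).boxProd (SimpleGraph.pathGraph n)

lemma grid_edist (n : ℕ) (u v : Fin n × Fin n) :
    (grid n).edist u v = (ad u.1 v.1 + ad u.2 v.2 : ℕ) := by
  rw [SimpleGraph.edist_boxProd, path_edist, path_edist]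
  push_cast; rfl

lemma grid_ad_iso {n : ℕ} (σ : grid n ≃g grid n) (u v : Fin n × Fin n) :
    ad (σ u).1 (σ v).1 + ad (σ u).2 (σ v).2 = ad u.1 v.1 + ad u.2 v.2 := by
  have := edist_iso σ u v
  rw [grid_edist, grid_edist] at this
  exact_mod_cast this

lemma grid_fold_iso_le {n : ℕ} (σ : grid n ≃g grid n) (u : Fin n × Fin n) :
    fold n (σ u).1 + fold n (σ u).2 ≤ fold n u.1 + fold n u.2 := by
  obtain ⟨k, hk⟩ := fold_far n u.1
  obtain ⟨l, hl⟩ := fold_far n u.2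
  have h0 := grid_ad_iso σ u (k, l)
  have h1 := fold_le n (σ u).1 (σ (k, l)).1
  have h2 := fold_le n (σ u).2 (σ (k, l)).2
  have := fold_lt n u.1
  have := fold_lt n u.2
  simp only at h0
  omega

lemma grid_fold_iso {n : ℕ} (σ : grid n ≃g grid n) (u : Fin n × Fin n) :
    fold n (σ u).1 + fold n (σ u).2 = fold n u.1 + fold n u.2 := by
  refine le_antisymm (grid_fold_iso_le σ u) ?_
  simpa using grid_fold_iso_le σ.symm (σ u)

lemma grid_sum (n : ℕ) (u : Fin n × Fin n) :
    ∑ v : Fin n × Fin n, (ad u.1 v.1 + ad u.2 v.2) =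
      n * (∑ k : Fin n, ad u.1 k + ∑ k : Fin n, ad u.2 k) := by
  rw [Fintype.sum_prod_type]
  simp [Finset.sum_add_distrib, Finset.mul_sum, mul_add]

lemma grid_sum_iso {n : ℕ} (σ : grid n ≃g grid n) (u : Fin n × Fin n) :
    ∑ v : Fin n × Fin n, (ad (σ u).1 v.1 + ad (σ u).2 v.2) =
      ∑ v : Fin n × Fin n, (ad u.1 v.1 + ad u.2 v.2) := by
  rw [← Equiv.sum_comp σ.toEquiv]
  exact Finset.sum_congr rfl fun v _ => grid_ad_iso σ u v

lemma sym2_arith (N a b c d : ℕ) (ha : a ≤ N) (hb : b ≤ N) (hc : c ≤ N) (hd : d ≤ N)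
    (h : a + b = c + d)
    (hs : (a * (a + 1) + (N - a) * (N - a + 1)) + (b * (b + 1) + (N - b) * (N - b + 1)) =
      (c * (c + 1) + (N - c) * (N - c + 1)) + (d * (d + 1) + (N - d) * (N - d + 1))) :
    s(a, b) = s(c, d) := by
  rw [Sym2.eq_iff]
  zify [ha, hb, hc, hd] at h hs ⊢
  have hb' : (b : ℤ) = c + d - a := by linarith
  rw [hb'] at hs
  have : ((a : ℤ) - c) * (a - d) = 0 := by nlinarith
  rcases mul_eq_zero.mp this with h1 | h1
  · left; constructor <;> linarith
  · right; constructor <;> linarith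

/-- The complete orbit invariant on the grid. -/
def fold2 (n : ℕ) (u : Fin n × Fin n) : Sym2 ℕ := s(fold n u.1, fold n u.2)

lemma grid_fold2_iso {n : ℕ} (σ : grid n ≃g grid n) (u : Fin n × Fin n) :
    fold2 n (σ u) = fold2 n u := by
  have hn : 0 < n := lt_of_le_of_lt (Nat.zero_le _) u.1.2
  have hs := grid_sum_iso σ u
  rw [grid_sum, grid_sum] at hs
  have hs := Nat.eq_of_mul_eq_mul_left hn hs
  have h1 := fold_lt n u.1
  have h2 := fold_lt n u.2
  have h3 := fold_lt n (σ u).1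
  have h4 := fold_lt n (σ u).2
  refine sym2_arith (n - 1) _ _ _ _ (by omega) (by omega) (by omega) (by omega)
    (grid_fold_iso σ u) ?_
  rw [← sum_ad, ← sum_ad, ← sum_ad, ← sum_ad, ← mul_add, ← mul_add, hs]

/-- Product of two automorphisms. -/
def prodIso {n : ℕ} (σ τ : SimpleGraph.pathGraph n ≃g SimpleGraph.pathGraph n) :
    grid n ≃g grid n where
  toEquiv := Equiv.prodCongr σ.toEquiv τ.toEquiv
  map_rel_iff' := by
    intro a b
    have h1 : ∀ x y, (SimpleGraph.pathGraph n).Adj (σ x) (σ y) ↔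
      (SimpleGraph.pathGraph n).Adj x y := fun x y => σ.map_adj_iff
    have h2 : ∀ x y, (SimpleGraph.pathGraph n).Adj (τ x) (τ y) ↔
      (SimpleGraph.pathGraph n).Adj x y := fun x y => τ.map_adj_iff
    simp [SimpleGraph.boxProd_adj, h1, h2]

lemma grid_exists_iso {n : ℕ} (u v : Fin n × Fin n) (h : fold2 n u = fold2 n v) :
    ∃ σ : grid n ≃g grid n, σ u = v := by
  unfold fold2 at h
  rw [Sym2.eq_iff] at h
  rcases h with ⟨h1, h2⟩ | ⟨h1, h2⟩
  · obtain ⟨σ, hσ⟩ := path_exists_iso _ _ h1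
    obtain ⟨τ, hτ⟩ := path_exists_iso _ _ h2
    exact ⟨prodIso σ τ, Prod.ext hσ hτ⟩
  · obtain ⟨σ, hσ⟩ := path_exists_iso _ _ h1
    obtain ⟨τ, hτ⟩ := path_exists_iso _ _ h2
    exact ⟨(prodIso σ τ).trans (SimpleGraph.boxProdComm _ _), Prod.ext hτ hσ⟩

lemma transitivityNumber_eq {V W : Type*} (G : SimpleGraph V) (F : V → W)
    (h1 : ∀ (σ : G ≃g G) u, F (σ u) = F u)
    (h2 : ∀ u v, F u = F v → ∃ σ : G ≃g G, σ u = v) :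
    transitivityNumber G = (Set.range F).ncard := by
  have key : ∀ v, autOrbit G v = F ⁻¹' {F v} := by
    intro v
    ext u
    constructor
    · rintro ⟨σ, rfl⟩
      exact h1 σ v
    · intro h
      exact h2 v u (Eq.symm h)
  have hr : Set.range (autOrbit G) = (fun w => F ⁻¹' {w}) '' Set.range F := by
    rw [← Set.range_comp]
    congr 1
    funext v
    exact key v
  unfold transitivityNumber
  rw [hr]
  apply Set.ncard_image_of_injOn
  rintro _ ⟨a, rfl⟩ _ ⟨b, rfl⟩ h
  have : a ∈ F ⁻¹' {F b} := by
    rw [← show F ⁻¹' {F a} = F ⁻¹' {F b} from h]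
    rfl
  exact this

lemma fold_surj (n a : ℕ) (h : a < (n + 1) / 2) : ∃ i : Fin n, fold n i = a :=
  ⟨⟨a, by omega⟩, by unfold fold; simp only; omega⟩

lemma range_fold (n : ℕ) : Set.range (fold n) = (Finset.range ((n + 1) / 2) : Set ℕ) := by
  ext a
  simp only [Set.mem_range, Finset.coe_range, Set.mem_Iio]
  constructor
  · rintro ⟨i, rfl⟩
    exact fold_lt n i
  · exact fold_surj n a

lemma range_fold2 (n : ℕ) :
    Set.range (fold2 n) = ((Finset.range ((n + 1) / 2)).sym2 : Set (Sym2 ℕ)) := by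
  ext z
  induction z with
  | h a b =>
  rw [Finset.mem_coe, Finset.mk_mem_sym2_iff, Finset.mem_range, Finset.mem_range]
  constructor
  · rintro ⟨u, hu⟩
    have h1 := fold_lt n u.1
    have h2 := fold_lt n u.2
    unfold fold2 at hu
    rw [Sym2.eq_iff] at hu
    omega
  · rintro ⟨ha, hb⟩
    obtain ⟨i, hi⟩ := fold_surj n a ha
    obtain ⟨j, hj⟩ := fold_surj n b hb
    exact ⟨(i, j), by simp [fold2, hi, hj]⟩

/-- For a path `P` on `n` vertices with transitivity number `r`, the
transitivity number of `P □ P` is `r(r+1)/2`. -/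
theorem transitivityNumber_boxProd_path_self (n r : ℕ)
    (hr : transitivityNumber (SimpleGraph.pathGraph n) = r) :
    transitivityNumber ((SimpleGraph.pathGraph n).boxProd (SimpleGraph.pathGraph n)) =
      r * (r + 1) / 2 := by
  rw [transitivityNumber_eq _ (fold n) path_fold_iso path_exists_iso, range_fold,
    Set.ncard_coe_finset, Finset.card_range] at hr
  rw [transitivityNumber_eq _ (fold2 n) grid_fold2_iso grid_exists_iso, range_fold2,
    Set.ncard_coe_finset, Finset.card_sym2, Finset.card_range, hr, Nat.choose_two_right]
  simp [mul_comm]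
end
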